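/- arXiv:2206.14031 — 2 statements merged into one kernel-verified Lean document; each statement's English description precedes it below -/
import Mathlib

section
/- Under the spherically symmetric Einstein–scalar field system with cosmological constant Λ, at every point where ∂_u r ≠ 0 and ∂_v r ≠ 0, the modified Hawking mass ϖ := m − (Λ/6) r³ satisfies ∂_u ϖ = ((1−μ)/(2 ∂_u r))·r²·(∂_u φ)² and ∂_v ϖ = ((1−μ)/(2 ∂_v r))·r²·(∂_v φ)². Consequently, at every point of the trapped region, i.e. where ∂_u r < 0, ∂_v r < 0 and μ > 1, one has ∂_u ϖ ≥ 0 and ∂_v ϖ ≥ 0. -/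
open Real Filter Set

/-- Partial derivative in the first (u) coordinate. -/
noncomputable def pdu (f : ℝ × ℝ → ℝ) (z : ℝ × ℝ) : ℝ :=
  deriv (fun x => f (x, z.2)) z.1

/-- Partial derivative in the second (v) coordinate. -/
noncomputable def pdv (f : ℝ × ℝ → ℝ) (z : ℝ × ℝ) : ℝ :=
  deriv (fun y => f (z.1, y)) z.2

theorem hasDerivAt_pdu {f : ℝ × ℝ → ℝ} {z : ℝ × ℝ} (hf : DifferentiableAt ℝ f z) :
    HasDerivAt (fun x => f (x, z.2)) (pdu f z) z.1 := by
  have hz : DifferentiableAt ℝ (fun x : ℝ => f (x, z.2)) z.1 :=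
    DifferentiableAt.comp (f := fun x : ℝ => (x, z.2)) z.1 hf
      (differentiableAt_id.prodMk (differentiableAt_const _))
  exact hz.hasDerivAt

theorem hasDerivAt_pdv {f : ℝ × ℝ → ℝ} {z : ℝ × ℝ} (hf : DifferentiableAt ℝ f z) :
    HasDerivAt (fun y => f (z.1, y)) (pdv f z) z.2 := by
  have hz : DifferentiableAt ℝ (fun y : ℝ => f (z.1, y)) z.2 :=
    DifferentiableAt.comp (f := fun y : ℝ => (z.1, y)) z.2 hf
      ((differentiableAt_const _).prodMk differentiableAt_id)
  exact hz.hasDerivAt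

theorem pdu_eq_fderiv {f : ℝ × ℝ → ℝ} {z : ℝ × ℝ} (hf : DifferentiableAt ℝ f z) :
    pdu f z = fderiv ℝ f z (1, 0) :=
  (hf.hasFDerivAt.comp_hasDerivAt (f := fun x : ℝ => (x, z.2)) z.1
    ((hasDerivAt_id _).prodMk (hasDerivAt_const _ _))).deriv

theorem pdv_eq_fderiv {f : ℝ × ℝ → ℝ} {z : ℝ × ℝ} (hf : DifferentiableAt ℝ f z) :
    pdv f z = fderiv ℝ f z (0, 1) :=
  (hf.hasFDerivAt.comp_hasDerivAt (f := fun y : ℝ => (z.1, y)) z.2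
    ((hasDerivAt_const _ _).prodMk (hasDerivAt_id _))).deriv

theorem ContDiffAt.differentiableAt_pdu {f : ℝ × ℝ → ℝ} {z : ℝ × ℝ} (hf : ContDiffAt ℝ 2 f z) :
    DifferentiableAt ℝ (pdu f) z := by
  have hd : DifferentiableAt ℝ (fun w => fderiv ℝ f w (1, 0)) z :=
    ((hf.fderiv_right (m := 1) (by norm_num)).differentiableAt (by norm_num)).clm_apply
      (differentiableAt_const _)
  refine hd.congr_of_eventuallyEq ?_
  filter_upwards [hf.eventually (by simp)] with w hw
  exact pdu_eq_fderiv (hw.differentiableAt (by norm_num))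

theorem ContDiffAt.differentiableAt_pdv {f : ℝ × ℝ → ℝ} {z : ℝ × ℝ} (hf : ContDiffAt ℝ 2 f z) :
    DifferentiableAt ℝ (pdv f) z := by
  have hd : DifferentiableAt ℝ (fun w => fderiv ℝ f w (0, 1)) z :=
    ((hf.fderiv_right (m := 1) (by norm_num)).differentiableAt (by norm_num)).clm_apply
      (differentiableAt_const _)
  refine hd.congr_of_eventuallyEq ?_
  filter_upwards [hf.eventually (by simp)] with w hw
  exact pdv_eq_fderiv (hw.differentiableAt (by norm_num))

theorem modified_hawking_mass_propagation
    (Λ : ℝ) (hΛ : 0 < Λ) (D : Set (ℝ × ℝ)) (hD : IsOpen D)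
    (r Ω φ : ℝ × ℝ → ℝ)
    (hrC : ContDiffOn ℝ (⊤ : ℕ∞) r D) (hΩC : ContDiffOn ℝ (⊤ : ℕ∞) Ω D) (hφC : ContDiffOn ℝ (⊤ : ℕ∞) φ D)
    (hrpos : ∀ z ∈ D, 0 < r z) (hΩpos : ∀ z ∈ D, 0 < Ω z)
    (hsys1 : ∀ z ∈ D, pdu (fun w => r w * pdv r w) z = -(1/4) * Ω z ^ 2 * (1 - Λ * r z ^ 2))
    (hsys2 : ∀ z ∈ D, pdv (fun w => r w * pdu r w) z = -(1/4) * Ω z ^ 2 * (1 - Λ * r z ^ 2))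
    (hsys3 : ∀ z ∈ D, pdu (pdv (fun w => Real.log (Ω w ^ 2))) z =
      -2 * pdu φ z * pdv φ z + (1/2) * (r z)⁻¹ ^ 2 * Ω z ^ 2
        + 2 * (r z)⁻¹ ^ 2 * pdu r z * pdv r z)
    (hsys4 : ∀ z ∈ D, r z * pdu (pdv φ) z = -(pdu r z) * pdv φ z - pdv r z * pdu φ z)
    (hsys5 : ∀ z ∈ D, pdu (fun w => (Ω w ^ 2)⁻¹ * pdu r w) z
      = -(r z) * (Ω z ^ 2)⁻¹ * (pdu φ z) ^ 2)
    (hsys6 : ∀ z ∈ D, pdv (fun w => (Ω w ^ 2)⁻¹ * pdv r w) z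
      = -(r z) * (Ω z ^ 2)⁻¹ * (pdv φ z) ^ 2)
    (m μ : ℝ × ℝ → ℝ)
    (hm : m = fun w => r w / 2 * (1 + 4 * (Ω w ^ 2)⁻¹ * pdu r w * pdv r w))
    (hμ : μ = fun w => 2 * m w / r w)
    (ϖ : ℝ × ℝ → ℝ) (hϖ : ϖ = fun w => m w - Λ / 6 * r w ^ 3) :
    ∀ z ∈ D,
      (pdu r z ≠ 0 → pdv r z ≠ 0 →
        pdu ϖ z = (1 - μ z) / (2 * pdu r z) * r z ^ 2 * (pdu φ z) ^ 2 ∧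
        pdv ϖ z = (1 - μ z) / (2 * pdv r z) * r z ^ 2 * (pdv φ z) ^ 2) ∧
      (pdu r z < 0 → pdv r z < 0 → 1 < μ z →
        0 ≤ pdu ϖ z ∧ 0 ≤ pdv ϖ z) := by
  intro z hz
  have hzD : D ∈ nhds z := hD.mem_nhds hz
  have hr2 : ContDiffAt ℝ 2 r z := contDiffAt_infty.1 (hrC.contDiffAt hzD) 2
  have hr : DifferentiableAt ℝ r z := hr2.differentiableAt (by norm_num)
  have hru : DifferentiableAt ℝ (pdu r) z := hr2.differentiableAt_pdu
  have hrv : DifferentiableAt ℝ (pdv r) z := hr2.differentiableAt_pdv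
  have hΩ : DifferentiableAt ℝ Ω z := (hΩC.contDiffAt hzD).differentiableAt (by simp)
  have hr0 : r z ≠ 0 := (hrpos z hz).ne'
  have hΩ0 : Ω z ≠ 0 := (hΩpos z hz).ne'
  have hΩinv : DifferentiableAt ℝ (fun w => (Ω w ^ 2)⁻¹) z :=
    (hΩ.pow 2).inv (pow_ne_zero 2 hΩ0)
  have hu : pdu ϖ z = -2 * r z ^ 2 * (Ω z ^ 2)⁻¹ * pdv r z * pdu φ z ^ 2 := by
    have hA := hasDerivAt_pdu (hΩinv.mul hru)
    have hB := hasDerivAt_pdu (hr.mul hrv)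
    have hR := hasDerivAt_pdu hr
    have key := ((hR.div_const 2).add ((hA.mul hB).const_mul 2)).sub
      ((hR.pow 3).const_mul (Λ / 6))
    have hA' := hsys5 z hz
    have hB' := hsys1 z hz
    have hϖu : ϖ = fun w => r w / 2 + 2 * (((Ω w ^ 2)⁻¹ * pdu r w) * (r w * pdv r w))
        - Λ / 6 * r w ^ 3 := by
      funext w
      simp only [hϖ, hm]
      ring
    rw [hϖu]
    refine Eq.trans key.deriv ?_
    change _ / 2 + 2 * (pdu (fun w => (Ω w ^ 2)⁻¹ * pdu r w) z * (r z * pdv r z)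
      + (Ω z ^ 2)⁻¹ * pdu r z * pdu (fun w => r w * pdv r w) z)
      - Λ / 6 * (((3 : ℕ) : ℝ) * r z ^ 2 * pdu r z) = _
    rw [hA', hB']
    push_cast
    field_simp
    ring
  have hv : pdv ϖ z = -2 * r z ^ 2 * (Ω z ^ 2)⁻¹ * pdu r z * pdv φ z ^ 2 := by
    have hA := hasDerivAt_pdv (hΩinv.mul hrv)
    have hB := hasDerivAt_pdv (hr.mul hru)
    have hR := hasDerivAt_pdv hr
    have key := ((hR.div_const 2).add ((hA.mul hB).const_mul 2)).sub
      ((hR.pow 3).const_mul (Λ / 6))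
    have hA' := hsys6 z hz
    have hB' := hsys2 z hz
    have hϖv : ϖ = fun w => r w / 2 + 2 * (((Ω w ^ 2)⁻¹ * pdv r w) * (r w * pdu r w))
        - Λ / 6 * r w ^ 3 := by
      funext w
      simp only [hϖ, hm]
      ring
    rw [hϖv]
    refine Eq.trans key.deriv ?_
    change _ / 2 + 2 * (pdv (fun w => (Ω w ^ 2)⁻¹ * pdv r w) z * (r z * pdu r z)
      + (Ω z ^ 2)⁻¹ * pdv r z * pdv (fun w => r w * pdu r w) z)
      - Λ / 6 * (((3 : ℕ) : ℝ) * r z ^ 2 * pdv r z) = _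
    rw [hA', hB']
    push_cast
    field_simp
    ring
  have hμz : 1 - μ z = -4 * (Ω z ^ 2)⁻¹ * pdu r z * pdv r z := by
    simp only [hμ, hm]
    field_simp
    ring
  refine ⟨fun hu0 hv0 => ⟨?_, ?_⟩, fun hu0 hv0 _ => ⟨?_, ?_⟩⟩
  · rw [hu, hμz]
    field_simp
    ring
  · rw [hv, hμz]
    field_simp
    ring
  · have h : 0 ≤ 2 * r z ^ 2 * (Ω z ^ 2)⁻¹ * pdu φ z ^ 2 := by positivity
    rw [hu]
    nlinarith [mul_nonneg h (neg_nonneg.2 hv0.le)]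
  · have h : 0 ≤ 2 * r z ^ 2 * (Ω z ^ 2)⁻¹ * pdv φ z ^ 2 := by positivity
    rw [hv]
    nlinarith [mul_nonneg h (neg_nonneg.2 hu0.le)]
end

section
/- Fix u and suppose on the segment {u}×[v₁,v₂] ⊆ D one has ∂_v(r ∂_u r) = −(1/4) Ω² (1 − Λ r²), 0 < 1 − Λ r² ≤ 1, Ω² ≤ D₀/r for a constant D₀ > 0, and −r ∂_v r ≥ c for a constant c > 0. Then |(r ∂_u r)(u,v₂) − (r ∂_u r)(u,v₁)| ≤ (D₀/(4c)) · (r(u,v₁) − r(u,v₂)). -/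
open Real Filter Set

theorem r_du_r_difference_bound
    (Λ : ℝ) (hΛ : 0 < Λ) (D : Set (ℝ × ℝ)) (hD : IsOpen D)
    (r Ω φ : ℝ × ℝ → ℝ)
    (hrC : ContDiffOn ℝ (⊤ : ℕ∞) r D) (hΩC : ContDiffOn ℝ (⊤ : ℕ∞) Ω D) (hφC : ContDiffOn ℝ (⊤ : ℕ∞) φ D)
    (hrpos : ∀ z ∈ D, 0 < r z) (hΩpos : ∀ z ∈ D, 0 < Ω z)
    (hsys1 : ∀ z ∈ D, pdu (fun w => r w * pdv r w) z = -(1/4) * Ω z ^ 2 * (1 - Λ * r z ^ 2))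
    (hsys2 : ∀ z ∈ D, pdv (fun w => r w * pdu r w) z = -(1/4) * Ω z ^ 2 * (1 - Λ * r z ^ 2))
    (hsys3 : ∀ z ∈ D, pdu (pdv (fun w => Real.log (Ω w ^ 2))) z =
      -2 * pdu φ z * pdv φ z + (1/2) * (r z)⁻¹ ^ 2 * Ω z ^ 2
        + 2 * (r z)⁻¹ ^ 2 * pdu r z * pdv r z)
    (hsys4 : ∀ z ∈ D, r z * pdu (pdv φ) z = -(pdu r z) * pdv φ z - pdv r z * pdu φ z)
    (hsys5 : ∀ z ∈ D, pdu (fun w => (Ω w ^ 2)⁻¹ * pdu r w) z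
      = -(r z) * (Ω z ^ 2)⁻¹ * (pdu φ z) ^ 2)
    (hsys6 : ∀ z ∈ D, pdv (fun w => (Ω w ^ 2)⁻¹ * pdv r w) z
      = -(r z) * (Ω z ^ 2)⁻¹ * (pdv φ z) ^ 2)
    (u v₁ v₂ Dc c : ℝ) (hv : v₁ ≤ v₂) (hDc : 0 < Dc) (hc : 0 < c)
    (hseg : ∀ t ∈ Set.Icc v₁ v₂, (u, t) ∈ D)
    (hΛr : ∀ t ∈ Set.Icc v₁ v₂, 0 < 1 - Λ * r (u, t) ^ 2 ∧ 1 - Λ * r (u, t) ^ 2 ≤ 1)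
    (hΩb : ∀ t ∈ Set.Icc v₁ v₂, Ω (u, t) ^ 2 ≤ Dc / r (u, t))
    (hrv : ∀ t ∈ Set.Icc v₁ v₂, c ≤ -(r (u, t) * pdv r (u, t))) :
    |r (u, v₂) * pdu r (u, v₂) - r (u, v₁) * pdu r (u, v₁)|
      ≤ Dc / (4 * c) * (r (u, v₁) - r (u, v₂)) := by
  have hF (t : ℝ) (ht : t ∈ Icc v₁ v₂) : HasDerivAt (fun y => r (u, y) * pdu r (u, y))
      (-(1/4) * Ω (u, t) ^ 2 * (1 - Λ * r (u, t) ^ 2)) t := by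
    have h := hsys2 (u, t) (hseg t ht)
    have hne : -(1/4) * Ω (u, t) ^ 2 * (1 - Λ * r (u, t) ^ 2) < 0 := by
      have := mul_pos (pow_pos (hΩpos _ (hseg t ht)) 2) (hΛr t ht).1
      linarith
    unfold pdv at h
    have hd := (differentiableAt_of_deriv_ne_zero (h.trans_ne hne.ne)).hasDerivAt
    rwa [h] at hd
  have hr (t : ℝ) (ht : t ∈ Icc v₁ v₂) :
      HasDerivAt (fun y => r (u, y)) (pdv r (u, t)) t := by
    refine (differentiableAt_of_deriv_ne_zero fun h => ?_).hasDerivAt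
    have := hrv t ht
    simp only [pdv, h] at this
    linarith
  have hanti : AntitoneOn (fun y => r (u, y) * pdu r (u, y)) (Icc v₁ v₂) := by
    refine antitoneOn_of_hasDerivWithinAt_nonpos (convex_Icc v₁ v₂)
      (fun t ht => (hF t ht).continuousAt.continuousWithinAt)
      (fun t ht => (hF t (interior_subset ht)).hasDerivWithinAt) fun t ht => ?_
    have := mul_nonneg (sq_nonneg (Ω (u, t))) (hΛr t (interior_subset ht)).1.le
    linarith
  have hmono : MonotoneOn (fun y => r (u, y) * pdu r (u, y) - Dc / (4 * c) * r (u, y))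
      (Icc v₁ v₂) := by
    have hG (t : ℝ) (ht : t ∈ Icc v₁ v₂) := (hF t ht).sub ((hr t ht).const_mul (Dc / (4 * c)))
    refine monotoneOn_of_hasDerivWithinAt_nonneg (convex_Icc v₁ v₂)
      (fun t ht => (hG t ht).continuousAt.continuousWithinAt)
      (fun t ht => (hG t (interior_subset ht)).hasDerivWithinAt) fun t ht => ?_
    replace ht := interior_subset ht
    have hrt := hrpos _ (hseg t ht)
    have hΩΛ : Ω (u, t) ^ 2 * (1 - Λ * r (u, t) ^ 2) ≤ Dc / r (u, t) :=
      (mul_le_of_le_one_right (sq_nonneg _) (hΛr t ht).2).trans (hΩb t ht)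
    have hdr : c / r (u, t) ≤ -pdv r (u, t) := by
      rw [div_le_iff₀ hrt]
      linarith [hrv t ht]
    have hK : Dc / (4 * c) * (c / r (u, t)) = 1 / 4 * (Dc / r (u, t)) := by
      field_simp
    have := mul_le_mul_of_nonneg_left hdr (by positivity : 0 ≤ Dc / (4 * c))
    linarith
  have hm₁ := left_mem_Icc.2 hv
  have hm₂ := right_mem_Icc.2 hv
  have h₁ := hanti hm₁ hm₂ hv
  have h₂ := hmono hm₁ hm₂ hv
  dsimp only at h₁ h₂
  rw [abs_of_nonpos (by linarith)]
  linarith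
end
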